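/- Let ε = (ε₁,…,ε_n) be a random vector with independent standard Gaussian coordinates and let A be a real symmetric n×n matrix with eigenvalues s₁,…,s_n ordered so that |s₁| ≥ … ≥ |s_n|. Then for every x > 0, P( |εᵀAε − tr(A)| > 2|s₁|x + 2(Σᵢ₌₁ⁿ sᵢ²)^{1/2} √x ) ≤ 2e^{−x}. -/

import Mathlib

open MeasureTheory ProbabilityTheory Matrix

lemma neg_log_one_sub_le {y : ℝ} (hy : |y| < 1) :
    -Real.log (1 - y) ≤ y + y ^ 2 / (2 * (1 - |y|)) := by
  have hne : 1 - |y| ≠ 0 := (sub_pos.mpr hy).ne'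
  have hgeo : HasSum (fun n : ℕ => |y| / 2 * |y| ^ n + if n = 0 then y - |y| / 2 else 0)
      (|y| / 2 * (1 - |y|)⁻¹ + (y - |y| / 2)) :=
    ((hasSum_geometric_of_lt_one (abs_nonneg y) hy).mul_left _).add (hasSum_ite_eq 0 _)
  refine (hasSum_le (fun n => ?_) (Real.hasSum_pow_div_log_of_abs_lt_one hy) hgeo).trans_eq ?_
  · rcases n with _ | n
    · simp
    · have hpow : y ^ (n + 1 + 1) ≤ |y| ^ (n + 1 + 1) := by
        rw [← abs_pow]; exact le_abs_self _
      calc y ^ (n + 1 + 1) / ((n + 1 : ℕ) + 1 : ℝ)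
          ≤ |y| ^ (n + 1 + 1) / ((n + 1 : ℕ) + 1 : ℝ) := by gcongr
        _ ≤ |y| ^ (n + 1 + 1) / 2 := by
          gcongr
          push_cast
          linarith [n.cast_nonneg (α := ℝ)]
        _ = _ := by simp; ring
  · rw [← sq_abs y]
    field_simp
    ring

lemma exp_mul_sq_sub_one_mul_gaussianPDFReal (u y : ℝ) :
    gaussianPDFReal 0 1 y * Real.exp (u * (y ^ 2 - 1)) =
      (Real.exp (-u) * (√(2 * Real.pi))⁻¹) * Real.exp (-(1 / 2 - u) * y ^ 2) := by
  simp only [gaussianPDFReal, NNReal.coe_one, mul_one, sub_zero]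
  rw [mul_assoc, ← Real.exp_add, mul_comm (Real.exp (-u)), mul_assoc, ← Real.exp_add]
  ring_nf

lemma integrable_exp_mul_sq_sub_one_gaussianReal {u : ℝ} (hu : u < 1 / 2) :
    Integrable (fun y => Real.exp (u * (y ^ 2 - 1))) (gaussianReal 0 1) := by
  rw [gaussianReal_of_var_ne_zero 0 one_ne_zero,
    integrable_withDensity_iff_integrable_smul₀' (by fun_prop) (by simp [gaussianPDF])]
  simp only [toReal_gaussianPDF, smul_eq_mul, exp_mul_sq_sub_one_mul_gaussianPDFReal]
  exact (integrable_exp_neg_mul_sq (sub_pos.mpr hu)).const_mul _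

lemma integral_exp_mul_sq_sub_one_gaussianReal {u : ℝ} (hu : u < 1 / 2) :
    ∫ y, Real.exp (u * (y ^ 2 - 1)) ∂gaussianReal 0 1 =
      Real.exp (-u - Real.log (1 - 2 * u) / 2) := by
  have h : 0 < 1 - 2 * u := by linarith
  rw [integral_gaussianReal_eq_integral_smul one_ne_zero]
  simp only [smul_eq_mul, exp_mul_sq_sub_one_mul_gaussianPDFReal]
  rw [integral_const_mul, integral_gaussian, mul_assoc, ← Real.sqrt_inv,
    ← Real.sqrt_mul (by positivity), sub_eq_add_neg (-u), Real.exp_add, ← neg_div,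
    ← Real.log_inv, Real.exp_half, Real.exp_log (by positivity)]
  congr 2
  have : 1 / 2 - u ≠ 0 := by linarith
  have := Real.pi_ne_zero
  field_simp

lemma integral_exp_mul_sq_sub_one_gaussianReal_le {u w : ℝ} (huw : |u| ≤ w) (hw : w < 1 / 2) :
    ∫ y, Real.exp (u * (y ^ 2 - 1)) ∂gaussianReal 0 1 ≤ Real.exp (u ^ 2 / (1 - 2 * w)) := by
  have habs : |2 * u| = 2 * |u| := by simp [abs_mul]
  rw [integral_exp_mul_sq_sub_one_gaussianReal ((le_abs_self u).trans_lt (huw.trans_lt hw)),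
    Real.exp_le_exp]
  have h := neg_log_one_sub_le (y := 2 * u) (by linarith)
  have h' : (2 * u) ^ 2 / (2 * (1 - |2 * u|)) ≤ 2 * (u ^ 2 / (1 - 2 * w)) := by
    rw [show 2 * (u ^ 2 / (1 - 2 * w)) = (2 * u) ^ 2 / (2 * (1 - 2 * w)) by
      have : 1 - 2 * w ≠ 0 := by linarith
      field_simp, habs]
    gcongr
    linarith
  linarith

section Tail
variable {ι : Type*} [Fintype ι]

lemma exp_mul_sum_sq_sub_one (s : ι → ℝ) (t : ℝ) (y : ι → ℝ) :
    Real.exp (t * ∑ i, s i * (y i ^ 2 - 1)) =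
      ∏ i, Real.exp (t * s i * (y i ^ 2 - 1)) := by
  rw [← Real.exp_sum, Finset.mul_sum]
  simp only [mul_assoc]

lemma measure_pi_gaussianReal_sum_sq_gt_le (s : ι → ℝ) {m x : ℝ} (hm : ∀ i, |s i| ≤ m)
    (hm0 : 0 ≤ m) (hs : 0 < ∑ i, s i ^ 2) (hx : 0 < x) :
    (Measure.pi fun _ : ι => gaussianReal 0 1)
      {y | 2 * m * x + 2 * √(∑ i, s i ^ 2) * √x < ∑ i, s i * (y i ^ 2 - 1)} ≤
      ENNReal.ofReal (Real.exp (-x)) := by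
  set a := √(∑ i, s i ^ 2) with ha_def
  set b := √x with hb_def
  have ha : 0 < a := Real.sqrt_pos.mpr hs
  have hb : 0 < b := Real.sqrt_pos.mpr hx
  have haa : ∑ i, s i ^ 2 = a ^ 2 := (Real.sq_sqrt hs.le).symm
  have hbb : x = b ^ 2 := (Real.sq_sqrt hx.le).symm
  have hden : 0 < a + 2 * m * b := by positivity
  set t := b / (a + 2 * m * b) with ht_def
  have ht : 0 < t := by positivity
  have htm : 1 - 2 * (t * m) = a / (a + 2 * m * b) := by rw [ht_def]; field_simp; ring
  have htm' : t * m < 1 / 2 := by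
    have : 0 < 1 - 2 * (t * m) := by rw [htm]; positivity
    linarith
  have habs i : |t * s i| ≤ t * m := by
    rw [abs_mul, abs_of_pos ht]
    exact mul_le_mul_of_nonneg_left (hm i) ht.le
  have hint : Integrable (fun y : ι → ℝ => Real.exp (t * ∑ i, s i * (y i ^ 2 - 1)))
      (Measure.pi fun _ : ι => gaussianReal 0 1) := by
    simp only [exp_mul_sum_sq_sub_one]
    exact Integrable.fintype_prod fun i => integrable_exp_mul_sq_sub_one_gaussianReal
      ((le_abs_self _).trans_lt ((habs i).trans_lt htm'))
  have hmgf : mgf (fun y : ι → ℝ => ∑ i, s i * (y i ^ 2 - 1))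
      (Measure.pi fun _ : ι => gaussianReal 0 1) t ≤
        Real.exp (t ^ 2 * a ^ 2 / (1 - 2 * (t * m))) := by
    simp only [mgf, exp_mul_sum_sq_sub_one]
    rw [integral_fintype_prod_eq_prod (f := fun i z => Real.exp (t * s i * (z ^ 2 - 1))),
      ← haa, Finset.mul_sum, Finset.sum_div, Real.exp_sum]
    refine Finset.prod_le_prod (fun i _ => integral_nonneg fun _ => (Real.exp_pos _).le)
      fun i _ => ?_
    rw [← mul_pow]
    exact integral_exp_mul_sq_sub_one_gaussianReal_le (habs i) htm'
  have hcher := (measure_ge_le_exp_mul_mgf (2 * m * x + 2 * a * b) ht.le hint).trans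
    (mul_le_mul_of_nonneg_left hmgf (Real.exp_pos _).le)
  rw [← Real.exp_add, show -t * (2 * m * x + 2 * a * b) + t ^ 2 * a ^ 2 / (1 - 2 * (t * m)) = -x by
    rw [htm, ht_def, hbb]; field_simp; ring] at hcher
  calc _ ≤ (Measure.pi fun _ : ι => gaussianReal 0 1)
        {y | 2 * m * x + 2 * a * b ≤ ∑ i, s i * (y i ^ 2 - 1)} :=
        measure_mono fun y hy => (Set.mem_ofPred_eq ▸ hy).le
    _ ≤ _ := by
        rw [← ofReal_measureReal]
        exact ENNReal.ofReal_le_ofReal hcher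

lemma measure_pi_gaussianReal_abs_sum_sq_gt_le (s : ι → ℝ) {m x : ℝ} (hm : ∀ i, |s i| ≤ m)
    (hm0 : 0 ≤ m) (hx : 0 < x) :
    (Measure.pi fun _ : ι => gaussianReal 0 1)
      {y | 2 * m * x + 2 * √(∑ i, s i ^ 2) * √x < |∑ i, s i * (y i ^ 2 - 1)|} ≤
      ENNReal.ofReal (2 * Real.exp (-x)) := by
  rcases (Finset.sum_nonneg fun i (_ : i ∈ Finset.univ) => sq_nonneg (s i)).eq_or_lt with h0 | hs
  · have hzero i : s i = 0 := by
      simpa using (Finset.sum_eq_zero_iff_of_nonneg fun i _ => sq_nonneg (s i)).mp h0.symm i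
        (Finset.mem_univ i)
    have hnonneg : 0 ≤ 2 * m * x := by positivity
    simp [hzero, hnonneg.not_gt]
  · have hneg := measure_pi_gaussianReal_sum_sq_gt_le (-s) (m := m) (x := x) (by simpa using hm)
      hm0 (by simpa using hs) hx
    simp only [Pi.neg_apply, neg_sq, neg_mul, Finset.sum_neg_distrib] at hneg
    rw [two_mul (Real.exp (-x)), ENNReal.ofReal_add (Real.exp_pos _).le (Real.exp_pos _).le]
    refine (measure_mono fun y hy => ?_).trans ((measure_union_le _ _).trans
      (add_le_add (measure_pi_gaussianReal_sum_sq_gt_le s hm hm0 hs hx) hneg))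
    simpa [lt_abs] using hy

end Tail

section Diagonalization
variable {ι : Type*} [Fintype ι]

lemma map_pi_gaussianReal_orthonormalBasis (b : OrthonormalBasis ι ℝ (EuclideanSpace ℝ ι)) :
    (Measure.pi fun _ : ι => gaussianReal 0 1).map
      (fun y => WithLp.ofLp (∑ i, y i • b i)) = Measure.pi fun _ : ι => gaussianReal 0 1 := by
  have h := (stdGaussian_eq_map_pi_orthonormalBasis b).symm.trans
    (map_pi_eq_stdGaussian (ι := ι)).symm
  have h' := congrArg (Measure.map (WithLp.ofLp (p := 2))) h
  rw [Measure.map_map (by fun_prop) (by fun_prop), Measure.map_map (by fun_prop) (by fun_prop)]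
    at h'
  exact h'.trans Measure.map_id

variable [DecidableEq ι]

lemma Matrix.IsHermitian.dotProduct_mulVec_sum_eigenvectorBasis {A : Matrix ι ι ℝ}
    (hA : A.IsHermitian) (y : ι → ℝ) :
    WithLp.ofLp (∑ i, y i • hA.eigenvectorBasis i) ⬝ᵥ
      A.mulVec (WithLp.ofLp (∑ i, y i • hA.eigenvectorBasis i)) =
      ∑ i, hA.eigenvalues i * y i ^ 2 := by
  have hmul : A.mulVec (WithLp.ofLp (∑ i, y i • hA.eigenvectorBasis i)) =
      WithLp.ofLp (∑ i, (hA.eigenvalues i * y i) • hA.eigenvectorBasis i) := by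
    simp only [WithLp.ofLp_sum, WithLp.ofLp_smul, Matrix.mulVec_sum, Matrix.mulVec_smul,
      hA.mulVec_eigenvectorBasis, smul_smul, mul_comm]
  have hinner (v w : EuclideanSpace ℝ ι) : WithLp.ofLp v ⬝ᵥ WithLp.ofLp w = inner ℝ w v := by
    simp [EuclideanSpace.inner_eq_star_dotProduct]
  rw [hmul, hinner, hA.eigenvectorBasis.orthonormal.inner_sum]
  simp only [conj_trivial, mul_assoc, sq]

end Diagonalization

/-- deviation inequality for a Gaussian quadratic form. For `ε` a
vector of independent standard Gaussians and `A` real symmetric with eigenvalues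
`sᵢ` (so that `|s₁| = maxᵢ |sᵢ|`), for every `x > 0`,
`P(|εᵀAε − tr A| > 2 maxᵢ|sᵢ| x + 2 (Σᵢ sᵢ²)^{1/2} √x) ≤ 2 e^{−x}`. -/
theorem stmt_8 (n : ℕ) (A : Matrix (Fin n) (Fin n) ℝ) (hA : A.IsHermitian)
    (x : ℝ) (hx : 0 < x) :
    (Measure.pi fun _ : Fin n => gaussianReal 0 1)
      {ω : Fin n → ℝ |
        2 * (⨆ i, |hA.eigenvalues i|) * x
          + 2 * Real.sqrt (∑ i, hA.eigenvalues i ^ 2) * Real.sqrt x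
        < |ω ⬝ᵥ A.mulVec ω - A.trace|}
      ≤ ENNReal.ofReal (2 * Real.exp (-x)) := by
  have hmeas : Measurable fun ω : Fin n → ℝ => |ω ⬝ᵥ A.mulVec ω - A.trace| := by
    unfold dotProduct mulVec dotProduct
    fun_prop
  rw [← map_pi_gaussianReal_orthonormalBasis hA.eigenvectorBasis,
    Measure.map_apply (by fun_prop) (measurableSet_lt measurable_const hmeas)]
  refine (measure_mono fun y hy => ?_).trans
    (measure_pi_gaussianReal_abs_sum_sq_gt_le hA.eigenvalues
      (fun i => le_ciSup (f := fun i => |hA.eigenvalues i|) (Set.finite_range _).bddAbove i)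
      (Real.iSup_nonneg fun _ => abs_nonneg _) hx)
  rw [Set.mem_preimage, Set.mem_ofPred_eq, hA.dotProduct_mulVec_sum_eigenvectorBasis] at hy
  simpa [hA.trace_eq_sum_eigenvalues, mul_sub,
    Finset.sum_sub_distrib] using hy
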